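/- (Entropic certainty for a non-connected inclusion, two-block case.) For i = 1, 2, let ψ_i ∈ ℂ^{n_i} ⊗ ℂ^{d_i} ⊗ ℂ^{m_i} with ‖ψ₁‖² + ‖ψ₂‖² = 1 and q_i := ‖ψ_i‖² > 0, and let ρ^{(i)} := |ψ_i⟩⟨ψ_i|/q_i with reduced density matrices ρ^{(i)}_{n_i d_i}, ρ^{(i)}_{n_i}, ρ^{(i)}_{d_i m_i}, ρ^{(i)}_{m_i}; assume ρ^{(i)}_{n_i} and ρ^{(i)}_{m_i} are positive definite. Let σ_i be a positive definite density matrix on ℂ^{d_i}, set λ_i := Tr(σ_i⁻¹) and σ_i' := λ_i⁻¹ σ_i⁻¹. Consider the block-diagonal density matrices ρ_M := diag(q₁ ρ^{(1)}_{n₁d₁}, q₂ ρ^{(2)}_{n₂d₂}), ρ_M^ε := diag(q₁ ρ^{(1)}_{n₁} ⊗ σ₁, q₂ ρ^{(2)}_{n₂} ⊗ σ₂), ρ_{N'} := diag(q₁ ρ^{(1)}_{d₁m₁}, q₂ ρ^{(2)}_{d₂m₂}), and ρ_{N'}^{ε'} := diag(q₁ σ₁' ⊗ ρ^{(1)}_{m₁},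 q₂ σ₂' ⊗ ρ^{(2)}_{m₂}). Then S(ρ_M ‖ ρ_M^ε) + S(ρ_{N'} ‖ ρ_{N'}^{ε'}) = q₁ log λ₁ + q₂ log λ₂. -/

import Mathlib

open Matrix Kronecker ComplexOrder

/-- Functional-calculus logarithm of a Hermitian matrix (real log of eigenvalues,
with the convention `log 0 = 0`); defined to be `0` on non-Hermitian matrices. -/
noncomputable def matLog {ι : Type*} [Fintype ι] [DecidableEq ι] (A : Matrix ι ι ℂ) :
    Matrix ι ι ℂ :=
  if h : A.IsHermitian then
    (h.eigenvectorUnitary : Matrix ι ι ℂ) *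
      Matrix.diagonal (fun i => (Real.log (h.eigenvalues i) : ℂ)) *
      star (h.eigenvectorUnitary : Matrix ι ι ℂ)
  else 0

/-- Relative entropy `S(ρ‖σ) = Tr(ρ (log ρ − log σ))`. -/
noncomputable def relEnt {ι : Type*} [Fintype ι] [DecidableEq ι] (ρ σ : Matrix ι ι ℂ) : ℂ :=
  (ρ * (matLog ρ - matLog σ)).trace

/-- Partial trace over the second tensor factor. -/
noncomputable def ptraceR {a b : Type*} [Fintype b] (ρ : Matrix (a × b) (a × b) ℂ) :
    Matrix a a ℂ :=
  Matrix.of fun i i' => ∑ j : b, ρ (i, j) (i', j)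

/-- Partial trace over the first tensor factor. -/
noncomputable def ptraceL {a b : Type*} [Fintype a] (ρ : Matrix (a × b) (a × b) ℂ) :
    Matrix b b ℂ :=
  Matrix.of fun j j' => ∑ i : a, ρ (i, j) (i, j')

/-- Rank-one matrix `|ψ⟩⟨ψ|`. -/
noncomputable def outer {ι : Type*} (ψ : ι → ℂ) : Matrix ι ι ℂ :=
  Matrix.of fun x y => ψ x * (starRingEnd ℂ) (ψ y)

/-- Reduced matrix on the first factor `ℂ^n` of `ℂ^n ⊗ (ℂ^d ⊗ ℂ^m)`. -/
noncomputable def redN {n d m : ℕ}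
    (ρ : Matrix (Fin n × Fin d × Fin m) (Fin n × Fin d × Fin m) ℂ) :
    Matrix (Fin n) (Fin n) ℂ := ptraceR ρ

/-- Reduced matrix on `ℂ^d ⊗ ℂ^m`. -/
noncomputable def redDM {n d m : ℕ}
    (ρ : Matrix (Fin n × Fin d × Fin m) (Fin n × Fin d × Fin m) ℂ) :
    Matrix (Fin d × Fin m) (Fin d × Fin m) ℂ := ptraceL ρ

/-- Reduced matrix on `ℂ^d`. -/
noncomputable def redD {n d m : ℕ}
    (ρ : Matrix (Fin n × Fin d × Fin m) (Fin n × Fin d × Fin m) ℂ) :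
    Matrix (Fin d) (Fin d) ℂ := ptraceR (ptraceL ρ)

/-- Reduced matrix on `ℂ^m`. -/
noncomputable def redM {n d m : ℕ}
    (ρ : Matrix (Fin n × Fin d × Fin m) (Fin n × Fin d × Fin m) ℂ) :
    Matrix (Fin m) (Fin m) ℂ := ptraceL (ptraceL ρ)

/-- Reduced matrix on `ℂ^n ⊗ ℂ^d`. -/
noncomputable def redND {n d m : ℕ}
    (ρ : Matrix (Fin n × Fin d × Fin m) (Fin n × Fin d × Fin m) ℂ) :
    Matrix (Fin n × Fin d) (Fin n × Fin d) ℂ :=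
  ptraceR (Matrix.reindex (Equiv.prodAssoc (Fin n) (Fin d) (Fin m)).symm
    (Equiv.prodAssoc (Fin n) (Fin d) (Fin m)).symm ρ)

open Polynomial in
theorem aux_poly (s : Finset ℝ) : ∃ p : ℂ[X], ∀ x ∈ s, p.eval (x : ℂ) = (Real.log x : ℂ) := by
  refine ⟨Lagrange.interpolate s (fun x : ℝ => (x : ℂ)) (fun x => (Real.log x : ℂ)), ?_⟩
  intro x hx
  exact Lagrange.eval_interpolate_at_node (v := fun x : ℝ => (x : ℂ)) _
    (fun a _ b _ h => Complex.ofReal_injective h) hx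

open Polynomial in
theorem aux_aeval_diag {ι : Type*} [Fintype ι] [DecidableEq ι] (U : Matrix ι ι ℂ)
    (hU : star U * U = 1) (d : ι → ℂ) (p : ℂ[X]) :
    aeval (U * diagonal d * star U) p = U * diagonal (fun i => p.eval (d i)) * star U := by
  have hU' : U * star U = 1 := mul_eq_one_comm.mp hU
  induction p using Polynomial.induction_on' with
  | add p q hp hq =>
    rw [map_add, hp, hq, ← add_mul, ← mul_add, diagonal_add]
    simp
  | monomial k a =>
    have hk : ∀ k : ℕ, (U * diagonal d * star U) ^ k = U * diagonal (fun i => d i ^ k) * star U := by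
      intro k
      induction k with
      | zero => simp [hU']
      | succ k ih =>
        rw [pow_succ, ih]
        calc _ = U * diagonal (fun i => d i ^ k) * (star U * U) * diagonal d * star U := by
              simp only [mul_assoc]
          _ = _ := by
              rw [hU, mul_one, mul_assoc U, diagonal_mul_diagonal]
              simp [pow_succ]
    rw [aeval_monomial, hk]
    have : (fun i => (monomial k a).eval (d i)) = a • (fun i => d i ^ k) := by
      ext i; simp
    rw [this, diagonal_smul]
    simp [Algebra.algebraMap_eq_smul_one]

theorem aux_unit {ι : Type*} [Fintype ι] [DecidableEq ι] {A : Matrix ι ι ℂ}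
    (h : A.IsHermitian) : star (h.eigenvectorUnitary : Matrix ι ι ℂ) *
      (h.eigenvectorUnitary : Matrix ι ι ℂ) = 1 :=
  Unitary.coe_star_mul_self h.eigenvectorUnitary

theorem aux_spec {ι : Type*} [Fintype ι] [DecidableEq ι] {A : Matrix ι ι ℂ}
    (h : A.IsHermitian) : A = (h.eigenvectorUnitary : Matrix ι ι ℂ) *
      diagonal (fun i => (h.eigenvalues i : ℂ)) *
      star (h.eigenvectorUnitary : Matrix ι ι ℂ) := by
  have := h.spectral_theorem
  rw [Unitary.conjStarAlgAut_apply] at this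
  exact this

open Polynomial in
/-- One polynomial computes the logarithm of all Hermitian matrices with spectrum in `s`. -/
theorem aux_matLog_poly {ι : Type*} [Fintype ι] [DecidableEq ι] {A : Matrix ι ι ℂ}
    (h : A.IsHermitian) (p : ℂ[X])
    (hp : ∀ i, p.eval (h.eigenvalues i : ℂ) = (Real.log (h.eigenvalues i) : ℂ)) :
    matLog A = aeval A p := by
  conv_rhs => rw [aux_spec h, aux_aeval_diag _ (aux_unit h)]
  simp only [hp]
  rw [matLog, dif_pos h]

theorem aux_herm {ι : Type*} [Fintype ι] [DecidableEq ι] (U : Matrix ι ι ℂ) (d : ι → ℝ) :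
    (U * diagonal (fun i => (d i : ℂ)) * star U).IsHermitian := by
  have hd : (diagonal (fun i => (d i : ℂ))).IsHermitian := by
    rw [isHermitian_diagonal_iff]
    intro i
    exact Complex.conj_ofReal _
  exact isHermitian_mul_mul_conjTranspose U hd

theorem aux_matLog {ι : Type*} [Fintype ι] [DecidableEq ι] {A : Matrix ι ι ℂ} (U : Matrix ι ι ℂ)
    (hU : star U * U = 1) (d : ι → ℝ) (hA : A = U * diagonal (fun i => (d i : ℂ)) * star U) :
    matLog A = U * diagonal (fun i => (Real.log (d i) : ℂ)) * star U := by
  have h : A.IsHermitian := by rw [hA]; exact aux_herm U d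
  obtain ⟨p, hp⟩ := aux_poly (Finset.univ.image h.eigenvalues ∪ Finset.univ.image d)
  rw [aux_matLog_poly h p (fun i => hp _ (by simp)), hA, aux_aeval_diag U hU]
  congr 3
  ext i
  exact hp _ (by simp)

theorem aux_eig {ι : Type*} [Fintype ι] [DecidableEq ι] {A : Matrix ι ι ℂ}
    (h : A.IsHermitian) : ∃ (U : Matrix ι ι ℂ) (d : ι → ℝ), star U * U = 1 ∧
      A = U * diagonal (fun i => (d i : ℂ)) * star U :=
  ⟨_, _, aux_unit h, aux_spec h⟩

theorem aux_eig_pos {ι : Type*} [Fintype ι] [DecidableEq ι] {A : Matrix ι ι ℂ}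
    (h : A.PosDef) : ∃ (U : Matrix ι ι ℂ) (d : ι → ℝ), star U * U = 1 ∧ (∀ i, 0 < d i) ∧
      A = U * diagonal (fun i => (d i : ℂ)) * star U :=
  ⟨_, _, aux_unit h.1, fun i => h.eigenvalues_pos i, aux_spec h.1⟩

theorem aux_log_blocks {ι κ : Type*} [Fintype ι] [DecidableEq ι] [Fintype κ] [DecidableEq κ]
    {A : Matrix ι ι ℂ} {B : Matrix κ κ ℂ} (hA : A.IsHermitian) (hB : B.IsHermitian) :
    matLog (fromBlocks A 0 0 B) = fromBlocks (matLog A) 0 0 (matLog B) := by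
  obtain ⟨U, a, hU, hA⟩ := aux_eig hA
  obtain ⟨V, b, hV, hB⟩ := aux_eig hB
  rw [aux_matLog U hU a hA, aux_matLog V hV b hB]
  have key : ∀ f : ℝ → ℝ, fromBlocks U 0 0 V *
      diagonal (fun i => (f (Sum.elim a b i) : ℂ)) * star (fromBlocks U 0 0 V)
      = fromBlocks (U * diagonal (fun i => (f (a i) : ℂ)) * star U) 0 0
        (V * diagonal (fun i => (f (b i) : ℂ)) * star V) := by
    intro f
    have : (fun i => (f (Sum.elim a b i) : ℂ))
      = Sum.elim (fun i => (f (a i) : ℂ)) (fun i => (f (b i) : ℂ)) := by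
      ext i; cases i <;> rfl
    rw [this, ← fromBlocks_diagonal, star_eq_conjTranspose, fromBlocks_conjTranspose]
    simp only [fromBlocks_multiply, star_eq_conjTranspose, conjTranspose_zero, Matrix.mul_zero, Matrix.zero_mul,
      add_zero, zero_add]
  rw [aux_matLog (fromBlocks U 0 0 V) _ (Sum.elim a b), key Real.log]
  · rw [hA, hB]; exact (key id).symm
  · rw [star_eq_conjTranspose, fromBlocks_conjTranspose]
    rw [star_eq_conjTranspose] at hU hV
    simp [fromBlocks_multiply, hU, hV]

theorem aux_log_kron {ι κ : Type*} [Fintype ι] [DecidableEq ι] [Fintype κ] [DecidableEq κ]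
    {A : Matrix ι ι ℂ} {B : Matrix κ κ ℂ} (hA : A.PosDef) (hB : B.PosDef) :
    matLog (A ⊗ₖ B) = matLog A ⊗ₖ 1 + 1 ⊗ₖ matLog B := by
  obtain ⟨U, a, hU, ha, hA⟩ := aux_eig_pos hA
  obtain ⟨V, b, hV, hb, hB⟩ := aux_eig_pos hB
  have hU' : U * star U = 1 := mul_eq_one_comm.mp hU
  have hV' : V * star V = 1 := mul_eq_one_comm.mp hV
  rw [aux_matLog U hU a hA, aux_matLog V hV b hB]
  have hs : star (U ⊗ₖ V) = star U ⊗ₖ star V := by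
    simp only [star_eq_conjTranspose, conjTranspose_kronecker]
  have key : ∀ f : ι → ℂ, ∀ g : κ → ℂ, (U ⊗ₖ V) * diagonal (fun i => f i.1 * g i.2) * star (U ⊗ₖ V)
      = (U * diagonal f * star U) ⊗ₖ (V * diagonal g * star V) := by
    intro f g
    rw [hs, ← diagonal_kronecker_diagonal, mul_kronecker_mul, mul_kronecker_mul]
  rw [aux_matLog (U ⊗ₖ V) _ (fun i => a i.1 * b i.2)]
  · have h1 := key (fun i => (Real.log (a i) : ℂ)) 1
    have h2 := key 1 (fun i => (Real.log (b i) : ℂ))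
    have e1 : diagonal (1 : ι → ℂ) = 1 := diagonal_one
    have e2 : diagonal (1 : κ → ℂ) = 1 := diagonal_one
    simp only [e1, e2, mul_one, hV', hU', Pi.one_apply, one_mul] at h1 h2
    rw [← h1, ← h2, ← add_mul, ← mul_add, diagonal_add]
    congr 3
    ext i
    rw [Real.log_mul (ha _).ne' (hb _).ne']
    push_cast
    rfl
  · rw [hA, hB, ← key]
    simp
  · rw [hs, ← mul_kronecker_mul, hU, hV, one_kronecker_one]

theorem aux_smul_diag {ι : Type*} [Fintype ι] [DecidableEq ι] (q : ℝ) (U : Matrix ι ι ℂ)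
    (a : ι → ℝ) : (q : ℂ) • (U * diagonal (fun i => (a i : ℂ)) * star U)
      = U * diagonal (fun i => ((q * a i : ℝ) : ℂ)) * star U := by
  have : (fun i => ((q * a i : ℝ) : ℂ)) = (q : ℂ) • (fun i => (a i : ℂ)) := by
    ext i; simp
  rw [this, diagonal_smul]
  simp

theorem aux_log_smul {ι : Type*} [Fintype ι] [DecidableEq ι]
    {A : Matrix ι ι ℂ} (hA : A.PosDef) {q : ℝ} (hq : 0 < q) :
    matLog ((q : ℂ) • A) = (Real.log q : ℂ) • 1 + matLog A := by
  obtain ⟨U, a, hU, ha, hA⟩ := aux_eig_pos hA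
  have hU' : U * star U = 1 := mul_eq_one_comm.mp hU
  rw [aux_matLog U hU a hA, aux_matLog U hU (fun i => q * a i) (by rw [hA, aux_smul_diag])]
  have : (Real.log q : ℂ) • (1 : Matrix ι ι ℂ)
      = U * diagonal (fun i => (Real.log q : ℂ)) * star U := by
    rw [← smul_one_eq_diagonal]
    simp [hU']
  rw [this, ← add_mul, ← mul_add, diagonal_add]
  congr 3
  ext i
  rw [Real.log_mul hq.ne' (ha i).ne']
  push_cast
  rfl

theorem aux_log_inv {ι : Type*} [Fintype ι] [DecidableEq ι]
    {A : Matrix ι ι ℂ} (hA : A.PosDef) : matLog A⁻¹ = - matLog A := by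
  obtain ⟨U, a, hU, ha, hA⟩ := aux_eig_pos hA
  have hU' : U * star U = 1 := mul_eq_one_comm.mp hU
  have hinv : A⁻¹ = U * diagonal (fun i => (((a i)⁻¹ : ℝ) : ℂ)) * star U := by
    apply inv_eq_right_inv
    rw [hA]
    calc _ = U * diagonal (fun i => (a i : ℂ)) * (star U * U) *
          diagonal (fun i => (((a i)⁻¹ : ℝ) : ℂ)) * star U := by simp only [mul_assoc]
      _ = 1 := by
        rw [hU, mul_one, mul_assoc U, diagonal_mul_diagonal]
        have : (fun i => (a i : ℂ) * (((a i)⁻¹ : ℝ) : ℂ)) = fun _ => 1 := by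
          ext i
          rw [← Complex.ofReal_mul, mul_inv_cancel₀ (ha i).ne', Complex.ofReal_one]
        rw [this, diagonal_one, mul_one, hU']
  rw [aux_matLog U hU a hA, aux_matLog U hU _ hinv]
  have : (fun i => (Real.log (a i)⁻¹ : ℂ)) = fun i => - (Real.log (a i) : ℂ) := by
    ext i; simp [Real.log_inv]
  rw [this, ← diagonal_neg, mul_neg, neg_mul]

theorem aux_tr_log_smul {ι : Type*} [Fintype ι] [DecidableEq ι]
    {A : Matrix ι ι ℂ} (hA : A.IsHermitian) {q : ℝ} (hq : 0 < q) :
    A * matLog ((q : ℂ) • A) = (Real.log q : ℂ) • A + A * matLog A := by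
  obtain ⟨U, a, hU, hA⟩ := aux_eig hA
  rw [aux_matLog U hU a hA, aux_matLog U hU (fun i => q * a i) (by rw [hA, aux_smul_diag])]
  have key : ∀ g : ι → ℂ, A * (U * diagonal g * star U)
      = U * diagonal (fun i => (a i : ℂ) * g i) * star U := by
    intro g
    rw [hA]
    calc _ = U * diagonal (fun i => (a i : ℂ)) * (star U * U) * diagonal g * star U := by
          simp only [mul_assoc]
      _ = _ := by rw [hU, mul_one, mul_assoc U, diagonal_mul_diagonal]
  rw [key, key]
  conv_rhs => rw [hA]
  rw [aux_smul_diag, ← add_mul, ← mul_add, diagonal_add]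
  congr 3
  ext i
  by_cases h : a i = 0
  · simp [h]
  · rw [Real.log_mul hq.ne' h]
    push_cast
    ring

open Polynomial in
theorem aux_pull {ι κ : Type*} [Fintype ι] [DecidableEq ι] [Fintype κ] [DecidableEq κ]
    (M : Matrix ι κ ℂ) (N : Matrix κ ι ℂ) (p : ℂ[X]) :
    N * aeval (M * N) p = aeval (N * M) p * N := by
  induction p using Polynomial.induction_on' with
  | add p q hp hq => simp [Matrix.mul_add, Matrix.add_mul, hp, hq]
  | monomial k a =>
    have hk : N * (M * N) ^ k = (N * M) ^ k * N := by
      induction k with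
      | zero => simp
      | succ k ih =>
        rw [pow_succ, ← Matrix.mul_assoc, ih, pow_succ]
        simp only [Matrix.mul_assoc]
    simp [aeval_monomial, Algebra.algebraMap_eq_smul_one, hk]

open Polynomial in
theorem aux_transpose {ι : Type*} [Fintype ι] [DecidableEq ι]
    (A : Matrix ι ι ℂ) (p : ℂ[X]) : aeval Aᵀ p = (aeval A p)ᵀ := by
  induction p using Polynomial.induction_on' with
  | add p q hp hq => simp [hp, hq]
  | monomial k a =>
    simp [aeval_monomial, Algebra.algebraMap_eq_smul_one, transpose_pow]

theorem aux_purity {ι κ : Type*} [Fintype ι] [DecidableEq ι] [Fintype κ] [DecidableEq κ]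
    (M : Matrix ι κ ℂ) (N : Matrix κ ι ℂ) (hA : (M * N).IsHermitian)
    (hB : ((N * M)ᵀ).IsHermitian) :
    ((M * N) * matLog (M * N)).trace = ((N * M)ᵀ * matLog (N * M)ᵀ).trace := by
  obtain ⟨p, hp⟩ := aux_poly (Finset.univ.image hA.eigenvalues ∪ Finset.univ.image hB.eigenvalues)
  rw [aux_matLog_poly hA p (fun i => hp _ (by simp)),
    aux_matLog_poly hB p (fun i => hp _ (by simp)), aux_transpose, ← transpose_mul,
    trace_transpose, Matrix.mul_assoc, aux_pull, trace_mul_comm, Matrix.mul_assoc]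

theorem aux_outer_purity {a b : Type*} [Fintype a] [DecidableEq a] [Fintype b] [DecidableEq b]
    (c : ℝ) (φ : a × b → ℂ) :
    (ptraceR ((c : ℂ) • outer φ)).IsHermitian ∧ (ptraceL ((c : ℂ) • outer φ)).IsHermitian ∧
    (ptraceR ((c : ℂ) • outer φ) * matLog (ptraceR ((c : ℂ) • outer φ))).trace
    = (ptraceL ((c : ℂ) • outer φ) * matLog (ptraceL ((c : ℂ) • outer φ))).trace := by
  have h1 : (ptraceR ((c : ℂ) • outer φ)).IsHermitian := by
    ext i j
    simp only [ptraceR, outer, conjTranspose_apply, of_apply, Matrix.smul_apply, smul_eq_mul,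
      star_sum]
    refine Finset.sum_congr rfl fun k _ => ?_
    simp only [star_mul', RCLike.star_def, Complex.conj_ofReal, Complex.conj_conj]
    ring
  have h2 : (ptraceL ((c : ℂ) • outer φ)).IsHermitian := by
    ext i j
    simp only [ptraceL, outer, conjTranspose_apply, of_apply, Matrix.smul_apply, smul_eq_mul,
      star_sum]
    refine Finset.sum_congr rfl fun k _ => ?_
    simp only [star_mul', RCLike.star_def, Complex.conj_ofReal, Complex.conj_conj]
    ring
  refine ⟨h1, h2, ?_⟩
  let M : Matrix a b ℂ := of fun i j => φ (i, j)
  let N : Matrix b a ℂ := of fun j i => (c : ℂ) * (starRingEnd ℂ) (φ (i, j))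
  have e1 : ptraceR ((c : ℂ) • outer φ) = M * N := by
    ext i j
    simp only [ptraceR, outer, of_apply, Matrix.smul_apply, smul_eq_mul, mul_apply, M, N]
    exact Finset.sum_congr rfl fun k _ => by ring
  have e2 : ptraceL ((c : ℂ) • outer φ) = (N * M)ᵀ := by
    ext i j
    simp only [ptraceL, outer, of_apply, Matrix.smul_apply, smul_eq_mul, mul_apply,
      transpose_apply, M, N]
    exact Finset.sum_congr rfl fun k _ => by ring
  rw [e1] at h1
  rw [e2] at h2
  rw [e1, e2]
  exact aux_purity M N h1 h2

theorem aux_ptraceR {a b : Type*} [Fintype a] [DecidableEq a] [Fintype b] [DecidableEq b]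
    (ρ : Matrix (a × b) (a × b) ℂ) (X : Matrix a a ℂ) :
    (ρ * (X ⊗ₖ (1 : Matrix b b ℂ))).trace = (ptraceR ρ * X).trace := by
  simp only [trace, diag_apply, mul_apply, ptraceR, of_apply, kroneckerMap_apply,
    Fintype.sum_prod_type, one_apply, mul_ite, mul_one, mul_zero, Finset.sum_ite_eq',
    Finset.mem_univ, if_true, Finset.sum_mul]
  exact Finset.sum_congr rfl fun i _ => Finset.sum_comm

theorem aux_ptraceL {a b : Type*} [Fintype a] [DecidableEq a] [Fintype b] [DecidableEq b]
    (ρ : Matrix (a × b) (a × b) ℂ) (X : Matrix b b ℂ) :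
    (ρ * ((1 : Matrix a a ℂ) ⊗ₖ X)).trace = (ptraceL ρ * X).trace := by
  simp only [trace, diag_apply, mul_apply, ptraceL, of_apply, kroneckerMap_apply,
    Fintype.sum_prod_type, one_apply, ite_mul, one_mul, zero_mul, Finset.sum_mul]
  rw [Finset.sum_comm]
  refine Finset.sum_congr rfl fun i _ => ?_
  rw [Finset.sum_comm]
  conv_rhs => rw [Finset.sum_comm]
  rw [Finset.sum_comm]
  refine Finset.sum_congr rfl fun j _ => ?_
  rw [Finset.sum_comm]
  simp

theorem aux_block {n d m : ℕ} (ψ : Fin n × Fin d × Fin m → ℂ) (q : ℝ)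
    (hq : q = ∑ x, Complex.normSq (ψ x)) (hqpos : 0 < q)
    (ρ : Matrix (Fin n × Fin d × Fin m) (Fin n × Fin d × Fin m) ℂ)
    (hρ : ρ = (q : ℂ)⁻¹ • outer ψ)
    (hρn : (redN ρ).PosDef) (hρm : (redM ρ).PosDef)
    (σ : Matrix (Fin d) (Fin d) ℂ) (hσ : σ.PosDef) (hσtr : σ.trace = 1)
    (l : ℝ) (hl : (σ⁻¹).trace = (l : ℂ))
    (σ' : Matrix (Fin d) (Fin d) ℂ) (hσ' : σ' = (l : ℂ)⁻¹ • σ⁻¹) :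
    ((q : ℂ) • redND ρ).IsHermitian ∧ ((q : ℂ) • (redN ρ ⊗ₖ σ)).IsHermitian ∧
    ((q : ℂ) • redDM ρ).IsHermitian ∧ ((q : ℂ) • (σ' ⊗ₖ redM ρ)).IsHermitian ∧
    relEnt ((q : ℂ) • redND ρ) ((q : ℂ) • (redN ρ ⊗ₖ σ))
      + relEnt ((q : ℂ) • redDM ρ) ((q : ℂ) • (σ' ⊗ₖ redM ρ)) = ((q * Real.log l : ℝ) : ℂ) := by
  have hqh : ∀ {ι : Type} (A : Matrix ι ι ℂ), A.IsHermitian → ((q : ℂ) • A).IsHermitian := by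
    intro ι A hA
    unfold IsHermitian
    rw [conjTranspose_smul, hA.eq]
    simp
  have hd : Nonempty (Fin d) := by
    by_contra h
    rw [not_nonempty_iff] at h
    simp [trace] at hσtr
  have hlpos : 0 < l := by
    have := hσ.inv.trace_pos
    rw [hl] at this
    exact_mod_cast this
  have hσ'pos : σ'.PosDef := by
    rw [hσ']
    refine hσ.inv.smul ?_
    have : 0 < l⁻¹ := inv_pos.mpr hlpos
    exact_mod_cast this
  -- reduced states
  have hρc : ρ = ((q⁻¹ : ℝ) : ℂ) • outer ψ := by rw [hρ]; push_cast; rfl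
  obtain ⟨_, hDM, pur1⟩ := aux_outer_purity q⁻¹ ψ
  rw [← hρc] at hDM pur1
  have hre : Matrix.reindex (Equiv.prodAssoc (Fin n) (Fin d) (Fin m)).symm
      (Equiv.prodAssoc (Fin n) (Fin d) (Fin m)).symm ρ
      = ((q⁻¹ : ℝ) : ℂ) • outer (ψ ∘ Equiv.prodAssoc (Fin n) (Fin d) (Fin m)) := by
    rw [hρc]; rfl
  obtain ⟨hND, _, pur2⟩ := aux_outer_purity q⁻¹ (ψ ∘ Equiv.prodAssoc (Fin n) (Fin d) (Fin m))
  rw [← hre] at hND pur2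
  have eM : ptraceL (Matrix.reindex (Equiv.prodAssoc (Fin n) (Fin d) (Fin m)).symm
      (Equiv.prodAssoc (Fin n) (Fin d) (Fin m)).symm ρ) = redM ρ := by
    ext i j
    simp only [redM, ptraceL, of_apply, Fintype.sum_prod_type, reindex_apply, submatrix_apply,
      Equiv.symm_symm, Equiv.prodAssoc_apply]
    exact Finset.sum_comm
  rw [eM] at pur2
  change (redND ρ).IsHermitian at hND
  change (redDM ρ).IsHermitian at hDM
  change (redND ρ * matLog (redND ρ)).trace = (redM ρ * matLog (redM ρ)).trace at pur2
  change (redN ρ * matLog (redN ρ)).trace = (redDM ρ * matLog (redDM ρ)).trace at pur1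
  have eN : ptraceR (redND ρ) = redN ρ := by
    ext i j
    simp [redN, redND, ptraceR, Fintype.sum_prod_type]
  have eD : ptraceL (redND ρ) = redD ρ := by
    ext i j
    simp only [redD, redND, ptraceR, ptraceL, of_apply, reindex_apply, submatrix_apply,
      Equiv.symm_symm, Equiv.prodAssoc_apply]
    exact Finset.sum_comm
  have eD2 : ptraceR (redDM ρ) = redD ρ := rfl
  have eM2 : ptraceL (redDM ρ) = redM ρ := rfl
  have hkn := hρn.kronecker hσ
  have hkm := hσ'pos.kronecker hρm
  refine ⟨hqh _ hND, hqh _ hkn.1, hqh _ hDM, hqh _ hkm.1, ?_⟩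
  have trρ : ρ.trace = 1 := by
    rw [hρ, trace_smul]
    have : (outer ψ).trace = (q : ℂ) := by
      rw [hq]
      simp [trace, outer, Complex.mul_conj]
    rw [this, smul_eq_mul, inv_mul_cancel₀]
    exact_mod_cast hqpos.ne'
  have trDM : (redDM ρ).trace = 1 := by
    rw [← trρ]
    simp only [trace, redDM, ptraceL, diag_apply, of_apply]
    rw [Fintype.sum_prod_type (f := fun x => ρ x x)]
    exact Finset.sum_comm
  have hlog' : matLog σ' = -((Real.log l : ℂ) • 1) - matLog σ := by
    have := aux_log_smul hσ.inv (inv_pos.mpr hlpos)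
    rw [aux_log_inv hσ, Real.log_inv] at this
    rw [hσ', ← Complex.ofReal_inv, this]
    push_cast
    rw [neg_smul, sub_eq_add_neg]
  have R1 : relEnt ((q : ℂ) • redND ρ) ((q : ℂ) • (redN ρ ⊗ₖ σ))
      = q * ((redM ρ * matLog (redM ρ)).trace - (redN ρ * matLog (redN ρ)).trace
        - (redD ρ * matLog σ).trace) := by
    rw [relEnt, aux_log_smul hkn hqpos, aux_log_kron hρn hσ, smul_mul, trace_smul, mul_sub,
      aux_tr_log_smul hND hqpos, mul_add, mul_add, Matrix.mul_smul, mul_one, trace_sub, trace_add,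
      trace_add, trace_add, aux_ptraceR, aux_ptraceL, eN, eD, pur2, smul_eq_mul]
    ring
  have R2 : relEnt ((q : ℂ) • redDM ρ) ((q : ℂ) • (σ' ⊗ₖ redM ρ))
      = q * ((redN ρ * matLog (redN ρ)).trace - (redM ρ * matLog (redM ρ)).trace
        - (redD ρ * matLog σ').trace) := by
    rw [relEnt, aux_log_smul hkm hqpos, aux_log_kron hσ'pos hρm, smul_mul, trace_smul, mul_sub,
      aux_tr_log_smul hDM hqpos, mul_add, mul_add, Matrix.mul_smul, mul_one, trace_sub, trace_add,
      trace_add, trace_add, aux_ptraceR, aux_ptraceL, eD2, eM2, ← pur1, smul_eq_mul]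
    ring
  have trD : (redD ρ).trace = 1 := by
    rw [← trDM, ← eD2]
    simp [trace, ptraceR, Fintype.sum_prod_type]
  rw [R1, R2, hlog', mul_sub (redD ρ), mul_neg, Matrix.mul_smul, mul_one, trace_sub, trace_neg, trace_smul, trD,
    smul_eq_mul]
  push_cast
  ring

theorem aux_relEnt_blocks {ι κ : Type*} [Fintype ι] [DecidableEq ι] [Fintype κ] [DecidableEq κ]
    {A A' : Matrix ι ι ℂ} {B B' : Matrix κ κ ℂ} (hA : A.IsHermitian) (hB : B.IsHermitian)
    (hA' : A'.IsHermitian) (hB' : B'.IsHermitian) :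
    relEnt (fromBlocks A 0 0 B) (fromBlocks A' 0 0 B') = relEnt A A' + relEnt B B' := by
  rw [relEnt, aux_log_blocks hA hB, aux_log_blocks hA' hB', relEnt, relEnt]
  rw [sub_eq_add_neg, fromBlocks_neg, fromBlocks_add, fromBlocks_multiply]
  simp [sub_eq_add_neg, trace, Fintype.sum_sum_type]

/-- **Entropic certainty for a non-connected inclusion (two-block case).** -/
theorem stmt13 {n₁ d₁ m₁ n₂ d₂ m₂ : ℕ}
    (ψ₁ : Fin n₁ × Fin d₁ × Fin m₁ → ℂ) (ψ₂ : Fin n₂ × Fin d₂ × Fin m₂ → ℂ)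
    (q₁ q₂ : ℝ)
    (hq₁ : q₁ = ∑ x, Complex.normSq (ψ₁ x)) (hq₂ : q₂ = ∑ x, Complex.normSq (ψ₂ x))
    (hqsum : q₁ + q₂ = 1) (hq₁pos : 0 < q₁) (hq₂pos : 0 < q₂)
    -- the normalized block states ρ⁽ⁱ⁾ = |ψᵢ⟩⟨ψᵢ| / qᵢ
    (ρ₁ : Matrix (Fin n₁ × Fin d₁ × Fin m₁) (Fin n₁ × Fin d₁ × Fin m₁) ℂ)
    (hρ₁ : ρ₁ = (q₁ : ℂ)⁻¹ • outer ψ₁)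
    (ρ₂ : Matrix (Fin n₂ × Fin d₂ × Fin m₂) (Fin n₂ × Fin d₂ × Fin m₂) ℂ)
    (hρ₂ : ρ₂ = (q₂ : ℂ)⁻¹ • outer ψ₂)
    (hρ₁n : (redN ρ₁).PosDef) (hρ₁m : (redM ρ₁).PosDef)
    (hρ₂n : (redN ρ₂).PosDef) (hρ₂m : (redM ρ₂).PosDef)
    -- the states σᵢ defining the conditional expectation, their indices λᵢ = Tr(σᵢ⁻¹)
    -- (written as the real numbers lᵢ), and the dual states σᵢ' = λᵢ⁻¹ σᵢ⁻¹
    (σ₁ : Matrix (Fin d₁) (Fin d₁) ℂ) (hσ₁ : σ₁.PosDef) (hσ₁tr : σ₁.trace = 1)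
    (σ₂ : Matrix (Fin d₂) (Fin d₂) ℂ) (hσ₂ : σ₂.PosDef) (hσ₂tr : σ₂.trace = 1)
    (l₁ l₂ : ℝ) (hl₁ : (σ₁⁻¹).trace = (l₁ : ℂ)) (hl₂ : (σ₂⁻¹).trace = (l₂ : ℂ))
    (σ₁' : Matrix (Fin d₁) (Fin d₁) ℂ) (hσ₁' : σ₁' = (l₁ : ℂ)⁻¹ • σ₁⁻¹)
    (σ₂' : Matrix (Fin d₂) (Fin d₂) ℂ) (hσ₂' : σ₂' = (l₂ : ℂ)⁻¹ • σ₂⁻¹)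
    -- the block-diagonal density matrices
    (ρM : Matrix ((Fin n₁ × Fin d₁) ⊕ (Fin n₂ × Fin d₂))
      ((Fin n₁ × Fin d₁) ⊕ (Fin n₂ × Fin d₂)) ℂ)
    (hρM : ρM = Matrix.fromBlocks ((q₁ : ℂ) • redND ρ₁) 0 0 ((q₂ : ℂ) • redND ρ₂))
    (ρMε : Matrix ((Fin n₁ × Fin d₁) ⊕ (Fin n₂ × Fin d₂))
      ((Fin n₁ × Fin d₁) ⊕ (Fin n₂ × Fin d₂)) ℂ)
    (hρMε : ρMε = Matrix.fromBlocks ((q₁ : ℂ) • (redN ρ₁ ⊗ₖ σ₁)) 0 0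
      ((q₂ : ℂ) • (redN ρ₂ ⊗ₖ σ₂)))
    (ρN' : Matrix ((Fin d₁ × Fin m₁) ⊕ (Fin d₂ × Fin m₂))
      ((Fin d₁ × Fin m₁) ⊕ (Fin d₂ × Fin m₂)) ℂ)
    (hρN' : ρN' = Matrix.fromBlocks ((q₁ : ℂ) • redDM ρ₁) 0 0 ((q₂ : ℂ) • redDM ρ₂))
    (ρN'ε' : Matrix ((Fin d₁ × Fin m₁) ⊕ (Fin d₂ × Fin m₂))
      ((Fin d₁ × Fin m₁) ⊕ (Fin d₂ × Fin m₂)) ℂ)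
    (hρN'ε' : ρN'ε' = Matrix.fromBlocks ((q₁ : ℂ) • (σ₁' ⊗ₖ redM ρ₁)) 0 0
      ((q₂ : ℂ) • (σ₂' ⊗ₖ redM ρ₂))) :
    relEnt ρM ρMε + relEnt ρN' ρN'ε'
      = ((q₁ * Real.log l₁ + q₂ * Real.log l₂ : ℝ) : ℂ) := by
  obtain ⟨a1, a2, a3, a4, a5⟩ := aux_block ψ₁ q₁ hq₁ hq₁pos ρ₁ hρ₁ hρ₁n hρ₁m σ₁ hσ₁ hσ₁tr l₁ hl₁
    σ₁' hσ₁'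
  obtain ⟨b1, b2, b3, b4, b5⟩ := aux_block ψ₂ q₂ hq₂ hq₂pos ρ₂ hρ₂ hρ₂n hρ₂m σ₂ hσ₂ hσ₂tr l₂ hl₂
    σ₂' hσ₂'
  rw [hρM, hρMε, hρN', hρN'ε', aux_relEnt_blocks a1 b1 a2 b2, aux_relEnt_blocks a3 b3 a4 b4,
    Complex.ofReal_add, ← a5, ← b5]
  ring
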